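/- (Sharpness of Adams' constant in dimension 4.) Let B be the open unit ball in ℝ⁴. For every β > 32π², the supremum of ∫_B e^{β u²} dx over all smooth functions u : ℝ⁴ → ℝ with compact support contained in B satisfying ∫_B (Δu)² dx ≤ 1 is infinite: for every M > 0 there is such a u with ∫_B e^{β u²} dx > M. -/

import Mathlib

noncomputable section

open MeasureTheory Real

/-- The Euclidean Laplacian of `u : ℝ⁴ → ℝ` at `x`. -/
def lap (u : EuclideanSpace ℝ (Fin 4) → ℝ) (x : EuclideanSpace ℝ (Fin 4)) : ℝ :=
  ∑ i, iteratedFDeriv ℝ 2 u x ![EuclideanSpace.single i 1, EuclideanSpace.single i 1]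

local notation "E4" => EuclideanSpace ℝ (Fin 4)

lemma lap_radial (f f1 f2 : ℝ → ℝ) (h1 : ∀ s, 0 ≤ s → HasDerivAt f (f1 s) s)
    (h2 : ∀ s, 0 ≤ s → HasDerivAt f1 (f2 s) s) (x : E4) :
    lap (fun x => f (‖x‖ ^ 2)) x = 4 * ‖x‖ ^ 2 * f2 (‖x‖ ^ 2) + 8 * f1 (‖x‖ ^ 2) := by
  have hn : ∀ x : E4, HasFDerivAt (fun x : E4 => ‖x‖ ^ 2) (2 • (innerSL ℝ x)) x :=
    fun x => (hasStrictFDerivAt_norm_sq x).hasFDerivAt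
  have hd : ∀ x : E4, HasFDerivAt (fun x : E4 => f (‖x‖ ^ 2))
      (f1 (‖x‖ ^ 2) • (2 • (innerSL ℝ x))) x := fun x =>
    (h1 _ (by positivity)).comp_hasFDerivAt x (hn x)
  have hfd : fderiv ℝ (fun x : E4 => f (‖x‖ ^ 2)) =
      fun x => f1 (‖x‖ ^ 2) • (2 • (innerSL ℝ x)) := by
    funext x; exact (hd x).fderiv
  have h22 : HasFDerivAt (fun x : E4 => f1 (‖x‖ ^ 2)) (f2 (‖x‖ ^ 2) • (2 • (innerSL ℝ x))) x :=
    (h2 _ (by positivity)).comp_hasFDerivAt x (hn x)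
  have hin : HasFDerivAt (fun x : E4 => 2 • (innerSL ℝ x)) (2 • (innerSL ℝ : E4 →L[ℝ] E4 →L[ℝ] ℝ)) x :=
    (innerSL ℝ : E4 →L[ℝ] E4 →L[ℝ] ℝ).hasFDerivAt.const_smul 2
  have h3 : HasFDerivAt (fun x : E4 => f1 (‖x‖ ^ 2) • (2 • (innerSL ℝ x))) _ x := h22.smul hin
  have hx : ‖x‖ ^ 2 = ∑ i, x i ^ 2 := by
    rw [EuclideanSpace.norm_sq_eq]; simp
  unfold lap
  simp only [iteratedFDeriv_two_apply]
  rw [hfd, h3.fderiv]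
  simp only [Matrix.cons_val_zero, Matrix.cons_val_one]
  simp
  rw [hx]
  have hi : ∀ i, inner ℝ x (EuclideanSpace.single i (1:ℝ)) = x i := fun i => by
    rw [EuclideanSpace.inner_single_right]; simp
  have hj : ∀ i : Fin 4, innerSL ℝ (EuclideanSpace.single i (1:ℝ) : E4)
      (EuclideanSpace.single i (1:ℝ)) = 1 := fun i => by
    rw [innerSL_apply_apply, EuclideanSpace.inner_single_right]; simp
  simp only [hi, hj, Fin.sum_univ_four]
  ring

lemma vol4 (r : ℝ) (hr : 0 ≤ r) : volume.real (Metric.ball (0:E4) r) = π ^ 2 / 2 * r ^ 4 := by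
  rw [Measure.real, EuclideanSpace.volume_ball]
  norm_num
  simp [hr]
  rw [ENNReal.toReal_ofReal (by positivity)]
  rw [show √π ^ 4 = (√π ^ 2) ^2 by ring, Real.sq_sqrt pi_pos.le]
  ring

lemma radial_int (g : ℝ → ℝ) : (∫ x in Metric.ball (0 : E4) 1, g ‖x‖) =
    2 * π ^ 2 * ∫ y in Set.Ioo (0:ℝ) 1, y ^ 3 * g y := by
  have h := integral_fun_norm_addHaar (volume : Measure E4) (Set.indicator (Set.Iio 1) g)
  have h1 : (fun x : E4 => Set.indicator (Set.Iio 1) g ‖x‖) =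
      Set.indicator (Metric.ball (0:E4) 1) (fun x => g ‖x‖) := by
    funext x; simp [Set.indicator]
  rw [h1, integral_indicator Metric.isOpen_ball.measurableSet] at h
  rw [h]
  have h2 : (fun y : ℝ => y ^ 3 * Set.indicator (Set.Iio 1) g y) =
    Set.indicator (Set.Iio 1) (fun y => y ^ 3 * g y) := by
    funext x; simp [Set.indicator]
  have h4 : (∫ y in Set.Ioi (0:ℝ), y ^ 3 * Set.indicator (Set.Iio 1) g y) =
     ∫ y in Set.Ioo (0:ℝ) 1, y ^ 3 * g y := by
    rw [h2, setIntegral_indicator measurableSet_Iio]; rfl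
  have h5 : volume.real (Metric.ball (0:E4) 1) = π ^ 2 / 2 := by simpa using vol4 1 zero_le_one
  simp [h5, h4]
  ring


lemma cutoff_exists : ∃ (χ χ1 χ2 : ℝ → ℝ) (K : ℝ), ContDiff ℝ (⊤ : ℕ∞) χ ∧
    Continuous χ1 ∧ Continuous χ2 ∧
    (∀ s, HasDerivAt χ (χ1 s) s) ∧ (∀ s, HasDerivAt χ1 (χ2 s) s) ∧
    (∀ s, s < 1 / 4 → χ s = 1 ∧ χ1 s = 0 ∧ χ2 s = 0) ∧
    (∀ s, 1 / 2 ≤ s → χ s = 0) ∧ 0 ≤ K ∧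
    (∀ s ∈ Set.Icc (0:ℝ) 1, |χ s| ≤ K ∧ |χ1 s| ≤ K ∧ |χ2 s| ≤ K) := by
  let χ : ℝ → ℝ := fun s => Real.smoothTransition (2 - 4 * s)
  have hc : ContDiff ℝ (⊤ : ℕ∞) χ :=
    Real.smoothTransition.contDiff.comp (by fun_prop)
  have hc1 : ContDiff ℝ (⊤ : ℕ∞) (deriv χ) := ((contDiff_infty_iff_deriv (𝕜 := ℝ)).1 hc).2
  have hc2 : ContDiff ℝ (⊤ : ℕ∞) (deriv (deriv χ)) :=
    ((contDiff_infty_iff_deriv (𝕜 := ℝ)).1 hc1).2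
  have e0 : ∀ s, s < 1 / 4 → χ s = 1 := fun s hs =>
    Real.smoothTransition.one_of_one_le (by linarith)
  have e1 : ∀ s, s < 1 / 4 → deriv χ s = 0 := fun s hs => by
    have : χ =ᶠ[nhds s] fun _ => 1 := by
      filter_upwards [Iio_mem_nhds hs] with t ht using e0 t ht
    rw [this.deriv_eq]; simp
  have e2 : ∀ s, s < 1 / 4 → deriv (deriv χ) s = 0 := fun s hs => by
    have : deriv χ =ᶠ[nhds s] fun _ => 0 := by
      filter_upwards [Iio_mem_nhds hs] with t ht using e1 t ht
    rw [this.deriv_eq]; simp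
  obtain ⟨K0, h0⟩ := (isCompact_Icc (a := (0:ℝ)) (b := 1)).exists_bound_of_continuousOn
    hc.continuous.continuousOn
  obtain ⟨K1, h1⟩ := (isCompact_Icc (a := (0:ℝ)) (b := 1)).exists_bound_of_continuousOn
    hc1.continuous.continuousOn
  obtain ⟨K2, h2⟩ := (isCompact_Icc (a := (0:ℝ)) (b := 1)).exists_bound_of_continuousOn
    hc2.continuous.continuousOn
  refine ⟨χ, deriv χ, deriv (deriv χ), |K0| + |K1| + |K2|, hc, hc1.continuous, hc2.continuous,
    fun s => (hc.differentiable (by simp) s).hasDerivAt,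
    fun s => (hc1.differentiable (by simp) s).hasDerivAt,
    fun s hs => ⟨e0 s hs, e1 s hs, e2 s hs⟩,
    fun s hs => Real.smoothTransition.zero_of_nonpos (by linarith), by positivity,
    fun s hs => ?_⟩
  have a0 := h0 s hs
  have a1 := h1 s hs
  have a2 := h2 s hs
  simp only [Real.norm_eq_abs] at a0 a1 a2
  have := le_abs_self K0
  have := le_abs_self K1
  have := le_abs_self K2
  have := abs_nonneg K0
  have := abs_nonneg K1
  have := abs_nonneg K2
  refine ⟨?_, ?_, ?_⟩ <;> linarith

/-- pointwise bound in the inner region -/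
lemma inner_bound (y δ : ℝ) (hy : 0 < y) (hδ : 0 < δ) :
    y ^ 3 * (4 * y ^ 2 * (1 / 2 / (y ^ 2 + δ) ^ 2) + 8 * (-(1 / 2) / (y ^ 2 + δ))) ^ 2 ≤
      4 * y / (y ^ 2 + δ) + 4 * δ * y / (y ^ 2 + δ) ^ 2 := by
  have ht : 0 < y ^ 2 + δ := by positivity
  rw [← sub_nonneg]
  have : 4 * y / (y ^ 2 + δ) + 4 * δ * y / (y ^ 2 + δ) ^ 2 -
    y ^ 3 * (4 * y ^ 2 * (1 / 2 / (y ^ 2 + δ) ^ 2) + 8 * (-(1 / 2) / (y ^ 2 + δ))) ^ 2 =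
    4 * y * δ ^ 2 * (y ^ 2 + 2 * δ) / (y ^ 2 + δ) ^ 4 := by
    field_simp
    ring
  rw [this]; positivity

lemma outer_bound (y δ K a a1 a2 : ℝ) (hy : 1 / 4 ≤ y ^ 2) (hy0 : 0 < y) (hy1 : y < 1) (hδ : 0 < δ)
    (hδ1 : δ < 1) (hK : 0 ≤ K) (ha : |a| ≤ K) (ha1 : |a1| ≤ K) (ha2 : |a2| ≤ K) :
    y ^ 3 * (4 * y ^ 2 * (a2 * (-(1 / 2) * log (y ^ 2 + δ)) + 2 * (a1 * (-(1 / 2) / (y ^ 2 + δ)))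
      + a * (1 / 2 / (y ^ 2 + δ) ^ 2)) +
      8 * (a1 * (-(1 / 2) * log (y ^ 2 + δ)) + a * (-(1 / 2) / (y ^ 2 + δ)))) ^ 2 ≤
      (76 * K) ^ 2 := by
  have hs1 : y ^ 2 ≤ 1 := by nlinarith
  have ht : 1 / 4 ≤ y ^ 2 + δ := by linarith
  have ht2 : y ^ 2 + δ ≤ 2 := by linarith
  generalize y ^ 2 + δ = t at ht ht2
  have hl : |-(1 / 2) * log t| ≤ 1 := by
    have h1 : log t ≤ 1 := by
      have := Real.log_le_sub_one_of_pos (show 0 < t by linarith); linarith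
    have h2 : -2 ≤ log t := by
      have h3 : log (1 / 4) ≤ log t := Real.log_le_log (by norm_num) ht
      have h4 : log (1 / 4) = - (2 * log 2) := by
        rw [show (1 / 4 : ℝ) = (2 ^ 2)⁻¹ by norm_num, Real.log_inv, Real.log_pow]; norm_num
      have := Real.log_two_lt_d9
      linarith
    rw [abs_le]; constructor <;> linarith
  have hl1 : |-(1 / 2) / t| ≤ 2 := by
    rw [abs_div, abs_of_pos (show 0 < t by linarith), div_le_iff₀ (by linarith)]
    norm_num; linarith
  have hl2 : |1 / 2 / t ^ 2| ≤ 8 := by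
    rw [abs_div, abs_of_pos (show 0 < t ^ 2 by positivity), div_le_iff₀ (by positivity)]
    norm_num; nlinarith
  generalize -(1 / 2) * log t = l at hl
  generalize -(1 / 2) / t = l1 at hl1
  generalize 1 / 2 / t ^ 2 = l2 at hl2
  have m : ∀ p q B : ℝ, |p| ≤ K → |q| ≤ B → |p * q| ≤ K * B := fun p q B hp hq => by
    rw [abs_mul]; exact mul_le_mul hp hq (abs_nonneg _) hK
  have b1 := abs_le.1 (m a2 l 1 ha2 hl)
  have b2 := abs_le.1 (m a1 l1 2 ha1 hl1)
  have b3 := abs_le.1 (m a l2 8 ha hl2)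
  have b4 := abs_le.1 (m a1 l 1 ha1 hl)
  have b5 := abs_le.1 (m a l1 2 ha hl1)
  have c1 : |a2 * l + 2 * (a1 * l1) + a * l2| ≤ 13 * K := abs_le.2 ⟨by linarith, by linarith⟩
  have c2 : |4 * y ^ 2 * (a2 * l + 2 * (a1 * l1) + a * l2)| ≤ 52 * K := by
    rw [abs_mul, abs_of_nonneg (by positivity : 0 ≤ 4 * y ^ 2)]
    have := abs_nonneg (a2 * l + 2 * (a1 * l1) + a * l2)
    nlinarith
  have c3 := abs_le.1 c2
  have c4 : |4 * y ^ 2 * (a2 * l + 2 * (a1 * l1) + a * l2) + 8 * (a1 * l + a * l1)| ≤ 76 * K :=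
    abs_le.2 ⟨by linarith, by linarith⟩
  have c5 := sq_le_sq' (abs_le.1 c4).1 (abs_le.1 c4).2
  have hy3 : y ^ 3 ≤ 1 := pow_le_one₀ hy0.le hy1.le
  calc _ ≤ 1 * (4 * y ^ 2 * (a2 * l + 2 * (a1 * l1) + a * l2) + 8 * (a1 * l + a * l1)) ^ 2 := by
        gcongr
    _ ≤ _ := by rw [one_mul]; exact c5

lemma main_int (δ : ℝ) (hδ : 0 < δ) (hδ1 : δ < 1) (C : ℝ) :
    (∫ y in Set.Ioo (0:ℝ) 1, (4 * y / (y ^ 2 + δ) + 4 * δ * y / (y ^ 2 + δ) ^ 2 + C)) ≤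
      2 * log (1 / δ) + 4 + C := by
  have hne : ∀ y : ℝ, y ^ 2 + δ ≠ 0 := fun y => by positivity
  have hF : ∀ y ∈ Set.uIcc (0:ℝ) 1, HasDerivAt
      (fun y => 2 * log (y ^ 2 + δ) - 2 * δ / (y ^ 2 + δ) + C * y)
      (4 * y / (y ^ 2 + δ) + 4 * δ * y / (y ^ 2 + δ) ^ 2 + C) y := fun y _ => by
    have h1 : HasDerivAt (fun y : ℝ => y ^ 2 + δ) (2 * y) y := by
      simpa using (hasDerivAt_pow 2 y).add_const δ
    have h2 := ((h1.log (hne y)).const_mul 2).sub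
      ((hasDerivAt_const y (2 * δ)).div h1 (hne y)) |>.add ((hasDerivAt_id y).const_mul C)
    refine h2.congr_deriv ?_
    have := hne y
    field_simp
    ring
  have hcont : Continuous (fun y : ℝ =>
      4 * y / (y ^ 2 + δ) + 4 * δ * y / (y ^ 2 + δ) ^ 2 + C) := by
    have : ∀ y : ℝ, (y ^ 2 + δ) ^ 2 ≠ 0 := fun y => pow_ne_zero _ (hne y)
    fun_prop (disch := assumption)
  rw [← integral_Ioc_eq_integral_Ioo, ← intervalIntegral.integral_of_le zero_le_one,
    intervalIntegral.integral_eq_sub_of_hasDerivAt hF (hcont.intervalIntegrable _ _)]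
  have h1 : log (1 ^ 2 + δ) ≤ 1 := by
    have := Real.log_le_sub_one_of_pos (show 0 < 1 ^ 2 + δ by linarith); linarith
  have h2 : 0 ≤ 2 * δ / (1 ^ 2 + δ) := by positivity
  have h3 : 2 * δ / (0 ^ 2 + δ) = 2 := by field_simp; ring
  have h4 : log (1 / δ) = - log δ := by rw [one_div, Real.log_inv]
  have h5 : log (0 ^ 2 + δ) = log δ := by norm_num
  rw [h3, h4, h5]
  generalize 2 * δ / (1 ^ 2 + δ) = q at h2
  generalize log (1 ^ 2 + δ) = p at h1
  linarith

lemma choose_L (β C m : ℝ) (hβ : β > 32 * π ^ 2) (hC : 0 ≤ C) :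
    ∃ Λ : ℝ, 2 ≤ Λ ∧
      m ≤ β * ((1 / 2 * (Λ - log 2)) ^ 2 / (4 * π ^ 2 * Λ + C)) - 2 * Λ := by
  set η := β - 32 * π ^ 2 with hη
  have hη0 : 0 < η := by linarith
  have hb : 0 < β := by have := pi_pos; nlinarith [sq_nonneg π]
  -- it suffices that η Λ² ≥ (2β + 8 C + 16 π² |m|) Λ + 4 C |m|
  set P := 2 * β + 8 * C + 16 * π ^ 2 * |m| + 4 * C * |m| with hP
  have hP0 : 0 ≤ P := by positivity
  refine ⟨2 + P / η, by have : 0 ≤ P / η := by positivity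
                        linarith, ?_⟩
  set Λ := 2 + P / η with hΛ
  have hL2 : 2 ≤ Λ := by have : 0 ≤ P / η := by positivity
                         linarith
  have hLP : P ≤ η * Λ := by
    rw [hΛ, mul_add, mul_div_cancel₀ _ hη0.ne']; linarith
  have hA : 0 < 4 * π ^ 2 * Λ + C := by have := pi_pos; positivity
  rw [le_sub_iff_add_le, ← mul_div_assoc, le_div_iff₀ hA]
  have hlog : log 2 ≤ 1 := by have := Real.log_two_lt_d9; linarith
  have hlog0 : 0 ≤ log 2 := Real.log_nonneg (by norm_num)
  have h1 : Λ ^ 2 - 2 * Λ ≤ (Λ - log 2) ^ 2 := by nlinarith [sq_nonneg (log 2)]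
  have h2 : P * Λ ≤ η * Λ ^ 2 := by nlinarith
  have h3 : β * (Λ ^ 2 - 2 * Λ) ≤ β * (Λ - log 2) ^ 2 := mul_le_mul_of_nonneg_left h1 hb.le
  have h4 : m * (4 * π ^ 2 * Λ + C) ≤ |m| * (4 * π ^ 2 * Λ + C) :=
    mul_le_mul_of_nonneg_right (le_abs_self m) hA.le
  have h5 : C * |m| ≤ C * |m| * Λ := le_mul_of_one_le_right (by positivity) (by linarith)
  have h6 : η * Λ ^ 2 = β * Λ ^ 2 - 32 * π ^ 2 * Λ ^ 2 := by rw [hη]; ring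
  have h7 : P * Λ = 2 * β * Λ + 8 * C * Λ + 16 * π ^ 2 * |m| * Λ + 4 * (C * |m| * Λ) := by
    rw [hP]; ring
  nlinarith

/-- Sharpness of Adams' constant `32π²` in dimension 4: for every `β > 32π²`,
the integrals `∫_B e^{β u²} dx` are unbounded over smooth `u` compactly
supported in the unit ball `B ⊆ ℝ⁴` with `∫_B (Δu)² dx ≤ 1`. -/
theorem adams_const_sharp (β : ℝ) (hβ : β > 32 * π ^ 2) (M : ℝ) (hM : M > 0) :
    ∃ u : EuclideanSpace ℝ (Fin 4) → ℝ, ContDiff ℝ (⊤ : ℕ∞) u ∧ HasCompactSupport u ∧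
      tsupport u ⊆ Metric.ball (0 : EuclideanSpace ℝ (Fin 4)) 1 ∧
      (∫ x in Metric.ball (0 : EuclideanSpace ℝ (Fin 4)) 1, (lap u x) ^ 2) ≤ 1 ∧
      (∫ x in Metric.ball (0 : EuclideanSpace ℝ (Fin 4)) 1,
        Real.exp (β * (u x) ^ 2)) > M := by
  obtain ⟨χ, χ1, χ2, K, hc, hc1, hc2, hd1, hd2, hin, hout, hK, hbd⟩ := cutoff_exists
  have hβ0 : 0 < β := by nlinarith [sq_nonneg π]
  set C : ℝ := 2 * π ^ 2 * (4 + (76 * K) ^ 2) with hC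
  have hC0 : 0 ≤ C := by positivity
  obtain ⟨Λ, hΛ, hm⟩ := choose_L β C M hβ hC0
  set A : ℝ := 4 * π ^ 2 * Λ + C with hA
  have hA0 : 0 < A := by have := pi_pos; positivity
  set δ : ℝ := exp (-Λ) with hδd
  have hδ : 0 < δ := exp_pos _
  have hδ4 : δ < 1 / 4 := by
    have h1 : δ ≤ exp (-2) := exp_le_exp.2 (by linarith)
    have h2 : exp (-2) < 1 / 4 := by
      rw [exp_neg, show (1 / 4 : ℝ) = 4⁻¹ by norm_num]
      apply inv_strictAnti₀ (by norm_num)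
      rw [show (2:ℝ) = 1 + 1 by norm_num, exp_add]
      have := exp_one_gt_d9
      nlinarith
    linarith
  have hlogδ : log δ = -Λ := log_exp _
  set c : ℝ := (√A)⁻¹ with hcd
  have hc2A : c ^ 2 = A⁻¹ := by rw [hcd, inv_pow, sq_sqrt hA0.le]
  have hc0 : 0 < c := inv_pos.2 (sqrt_pos.2 hA0)
  let f : ℝ → ℝ := fun s => c * (χ s * (-(1 / 2) * log (s + δ)))
  let f1 : ℝ → ℝ := fun s => c * (χ1 s * (-(1 / 2) * log (s + δ)) + χ s * (-(1 / 2) / (s + δ)))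
  let f2 : ℝ → ℝ := fun s => c * (χ2 s * (-(1 / 2) * log (s + δ)) +
    2 * (χ1 s * (-(1 / 2) / (s + δ))) + χ s * (1 / 2 / (s + δ) ^ 2))
  have hl0 : ∀ s : ℝ, 0 ≤ s → HasDerivAt (fun s => -(1 / 2) * log (s + δ))
      (-(1 / 2) / (s + δ)) s := fun s hs => by
    have h := (((hasDerivAt_id s).add_const δ).log
      (show s + δ ≠ 0 by positivity)).const_mul (-(1 / 2))
    refine h.congr_deriv ?_
    simp only [id]; ring
  have hl1 : ∀ s : ℝ, 0 ≤ s → HasDerivAt (fun s => -(1 / 2) / (s + δ))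
      (1 / 2 / (s + δ) ^ 2) s := fun s hs => by
    have h := (hasDerivAt_const s (-(1 / 2) : ℝ)).div ((hasDerivAt_id s).add_const δ)
      (show s + δ ≠ 0 by positivity)
    refine h.congr_deriv ?_
    simp only [id]; ring
  have hf1 : ∀ s, 0 ≤ s → HasDerivAt f (f1 s) s := fun s hs =>
    ((hd1 s).mul (hl0 s hs)).const_mul c
  have hf2 : ∀ s, 0 ≤ s → HasDerivAt f1 (f2 s) s := fun s hs => by
    refine ((((hd2 s).mul (hl0 s hs)).add ((hd1 s).mul (hl1 s hs))).const_mul c).congr_deriv ?_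
    simp only [f2]; ring
  have hpos : ∀ x : E4, ‖x‖ ^ 2 + δ ≠ 0 := fun x => by positivity
  have hsm : ContDiff ℝ (⊤ : ℕ∞) (fun x : E4 => f (‖x‖ ^ 2)) := by
    have hnn : ContDiff ℝ (⊤ : ℕ∞) (fun x : E4 => ‖x‖ ^ 2) := contDiff_norm_sq ℝ
    exact contDiff_const.mul ((hc.comp hnn).mul
      (contDiff_const.mul ((hnn.add contDiff_const).log hpos)))
  have hts : tsupport (fun x : E4 => f (‖x‖ ^ 2)) ⊆ Metric.closedBall 0 (3 / 4) := by
    apply closure_minimal _ Metric.isClosed_closedBall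
    intro x hx
    by_contra hx2
    apply hx
    have h1 : 3 / 4 < ‖x‖ := by simpa using hx2
    have h2 : χ (‖x‖ ^ 2) = 0 := hout _ (by nlinarith)
    simp [f, h2]
  refine ⟨fun x => f (‖x‖ ^ 2), hsm, ?_, ?_, ?_, ?_⟩
  · exact (isCompact_closedBall (0:E4) (3 / 4)).of_isClosed_subset (isClosed_tsupport _) hts
  · exact hts.trans (Metric.closedBall_subset_ball (by norm_num))
  · have h1 : (∫ x in Metric.ball (0 : E4) 1, (lap (fun x => f (‖x‖ ^ 2)) x) ^ 2) =
        ∫ x in Metric.ball (0 : E4) 1,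
          (fun y : ℝ => (4 * y ^ 2 * f2 (y ^ 2) + 8 * f1 (y ^ 2)) ^ 2) ‖x‖ := by
      congr 1; funext x; rw [lap_radial f f1 f2 hf1 hf2]
    rw [h1, radial_int (fun y : ℝ => (4 * y ^ 2 * f2 (y ^ 2) + 8 * f1 (y ^ 2)) ^ 2)]
    have hne : ∀ y : ℝ, y ^ 2 + δ ≠ 0 := fun y => by positivity
    have hne2 : ∀ y : ℝ, (y ^ 2 + δ) ^ 2 ≠ 0 := fun y => pow_ne_zero _ (hne y)
    have hcχ := hc.continuous
    have hcontl : Continuous (fun y : ℝ => y ^ 3 * (4 * y ^ 2 * f2 (y ^ 2) + 8 * f1 (y ^ 2)) ^ 2) := by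
      simp only [f1, f2]
      fun_prop (disch := assumption)
    have hcontr : Continuous (fun y : ℝ => c ^ 2 *
        (4 * y / (y ^ 2 + δ) + 4 * δ * y / (y ^ 2 + δ) ^ 2 + (76 * K) ^ 2)) := by
      fun_prop (disch := assumption)
    have hint : ∀ g : ℝ → ℝ, Continuous g → IntegrableOn g (Set.Ioo 0 1) := fun g hg =>
      (hg.integrableOn_Icc (a := 0) (b := 1)).mono_set Set.Ioo_subset_Icc_self
    have h2 := setIntegral_mono_on (hint _ hcontl) (hint _ hcontr) measurableSet_Ioo (by
      rintro y ⟨hy0, hy1⟩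
      have hfac : y ^ 3 * (4 * y ^ 2 * f2 (y ^ 2) + 8 * f1 (y ^ 2)) ^ 2 = c ^ 2 * (
          y ^ 3 * (4 * y ^ 2 * (χ2 (y ^ 2) * (-(1 / 2) * log (y ^ 2 + δ)) +
            2 * (χ1 (y ^ 2) * (-(1 / 2) / (y ^ 2 + δ)))
            + χ (y ^ 2) * (1 / 2 / (y ^ 2 + δ) ^ 2)) +
            8 * (χ1 (y ^ 2) * (-(1 / 2) * log (y ^ 2 + δ)) +
            χ (y ^ 2) * (-(1 / 2) / (y ^ 2 + δ)))) ^ 2) := by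
        simp only [f1, f2]; ring
      rw [hfac]
      apply mul_le_mul_of_nonneg_left _ (sq_nonneg c)
      by_cases hy : y ^ 2 < 1 / 4
      · obtain ⟨e0, e1, e2⟩ := hin _ hy
        rw [e0, e1, e2]
        have := inner_bound y δ hy0 hδ
        simp only [zero_mul, mul_zero, zero_add, one_mul]
        have := sq_nonneg (76 * K)
        linarith
      · obtain ⟨b0, b1, b2⟩ := hbd (y ^ 2) ⟨by positivity, by nlinarith⟩
        have h3 := outer_bound y δ K _ _ _ (not_lt.1 hy) hy0 hy1 hδ (by linarith) hK b0 b1 b2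
        have h4 : 0 ≤ 4 * y / (y ^ 2 + δ) := by positivity
        have h5 : 0 ≤ 4 * δ * y / (y ^ 2 + δ) ^ 2 := by positivity
        exact h3.trans (by linarith))
    rw [integral_const_mul] at h2
    have h3 := main_int δ hδ (by linarith) ((76 * K) ^ 2)
    rw [one_div, Real.log_inv, hlogδ, neg_neg] at h3
    calc _ ≤ 2 * π ^ 2 * (c ^ 2 * (2 * Λ + 4 + (76 * K) ^ 2)) := by
          apply mul_le_mul_of_nonneg_left _ (by positivity)
          exact h2.trans (mul_le_mul_of_nonneg_left h3 (sq_nonneg c))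
      _ = c ^ 2 * A := by rw [hA, hC]; ring
      _ = 1 := by rw [hc2A, inv_mul_cancel₀ hA0.ne']
      _ ≤ 1 := le_rfl
  · have hcont : Continuous (fun x : E4 => exp (β * (f (‖x‖ ^ 2)) ^ 2)) := by
      exact Real.continuous_exp.comp (continuous_const.mul (hsm.continuous.pow 2))
    have hI : IntegrableOn (fun x : E4 => exp (β * (f (‖x‖ ^ 2)) ^ 2)) (Metric.ball 0 1) :=
      (hcont.continuousOn.integrableOn_compact (isCompact_closedBall (0:E4) 1)).mono_set
        Metric.ball_subset_closedBall
    have hr1 : √δ ≤ 1 := Real.sqrt_le_one.2 (by linarith)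
    have hsub : Metric.ball (0:E4) (√δ) ⊆ Metric.ball 0 1 := Metric.ball_subset_ball hr1
    have h1 : (∫ x in Metric.ball (0:E4) (√δ), exp (β * (f (‖x‖ ^ 2)) ^ 2)) ≤
        ∫ x in Metric.ball (0:E4) 1, exp (β * (f (‖x‖ ^ 2)) ^ 2) :=
      setIntegral_mono_set hI (Filter.Eventually.of_forall fun x => (exp_pos _).le)
        hsub.eventuallyLE
    set T : ℝ := (1 / 2 * (Λ - log 2)) ^ 2 / A with hT
    have h2 : (∫ x in Metric.ball (0:E4) (√δ), exp (β * T)) ≤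
        ∫ x in Metric.ball (0:E4) (√δ), exp (β * (f (‖x‖ ^ 2)) ^ 2) := by
      apply setIntegral_mono_on _ (hI.mono_set hsub) Metric.isOpen_ball.measurableSet
      · intro x hx
        apply exp_le_exp.2
        apply mul_le_mul_of_nonneg_left _ hβ0.le
        have hx1 : ‖x‖ < √δ := by simpa using hx
        have hx2 : ‖x‖ ^ 2 < δ := (Real.lt_sqrt (norm_nonneg x)).1 hx1
        have e0 := (hin (‖x‖ ^ 2) (by linarith)).1
        have hlog : log (‖x‖ ^ 2 + δ) ≤ log 2 - Λ := by
          have : log (2 * δ) = log 2 - Λ := by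
            rw [Real.log_mul (by norm_num) hδ.ne', hlogδ]; ring
          rw [← this]
          exact Real.log_le_log (by positivity) (by linarith)
        have hlog2 : log 2 ≤ Λ := by have := Real.log_two_lt_d9; linarith
        simp only [f, e0]
        rw [mul_pow, hc2A, hT, div_eq_inv_mul]
        apply mul_le_mul_of_nonneg_left _ (by positivity)
        apply pow_le_pow_left₀ (by linarith)
        linarith
      · exact integrableOn_const (Metric.isBounded_ball.measure_lt_top.ne)
    rw [setIntegral_const, vol4 _ (sqrt_nonneg _), smul_eq_mul] at h2
    have h3 : √δ ^ 4 = exp (-2 * Λ) := by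
      rw [show √δ ^ 4 = (√δ ^ 2) ^ 2 by ring, sq_sqrt hδ.le, hδd, ← exp_nat_mul]
      congr 1; push_cast; ring
    have h4 : π ^ 2 / 2 * √δ ^ 4 * exp (β * T) = π ^ 2 / 2 * exp (β * T - 2 * Λ) := by
      rw [h3, mul_assoc, ← exp_add]; congr 2; ring
    have h5 : M < exp (β * T - 2 * Λ) := by
      have := add_one_le_exp (β * T - 2 * Λ)
      linarith
    have h6 : 1 ≤ π ^ 2 / 2 := by have := pi_gt_three; nlinarith
    have h7 : exp (β * T - 2 * Λ) ≤ π ^ 2 / 2 * exp (β * T - 2 * Λ) :=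
      le_mul_of_one_le_left (exp_pos _).le h6
    exact h5.trans_le (h7.trans (h4 ▸ h2.trans h1))

end
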